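/- In the setting of the four-block learning-aware gap bound theorem with the additional hypotheses t_k ≤ 1, finite Bregman diameters R_x, R_w, R_y, R_θ, B ≤ c₀/ε, and |ℓ_{k+1} − ℓ*| ≤ c₁/(k+1)², suppose further that (x*, w*, y*, θ*) is a saddle point of L(·, ·, ·, ·; ℓ*) on (dom f × W) × (dom h × Θ) with w* + 1 ∈ W. Then for every K ≥ 1: ℓ(θ̄_K) − ℓ* ≤ (1/T_K)·(R_x/τ₀ + R_w/τ₀ + R_y/σ₀ + R_θ/σ₀) + c₀c₁π²/(3 T_K ε) + ε. In particular, with ε = 1/√K the right-hand side equals (1/T_K)·(R_x/τ₀ + R_w/τ₀ + R_y/σ₀ + R_θ/σ₀) + c₀c₁π²√K/(3 T_K) + 1/√K. -/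

import Mathlib

open RealInnerProductSpace

/-- First-order optimality for the sum of a convex function and a differentiable one. -/
theorem ConvexOn.le_add_fderiv_of_forall_le {E : Type*} [NormedAddCommGroup E] [NormedSpace ℝ E]
    {C : Set E} {r φ : E → ℝ} {A : E →L[ℝ] ℝ} {u v : E} (hr : ConvexOn ℝ C r)
    (hu : u ∈ C) (hv : v ∈ C) (hφ : HasFDerivAt φ A u)
    (hmin : ∀ z ∈ C, r u + φ u ≤ r z + φ z) : r u ≤ r v + A (v - u) := by
  have hlim := (hφ.hasLineDerivAt (v - u)).tendsto_slope_zero_right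
  have hev : ∀ᶠ t : ℝ in nhdsWithin 0 (Set.Ioi 0),
      r u - r v ≤ t⁻¹ • (φ (u + (0 + t) • (v - u)) - φ (u + (0 : ℝ) • (v - u))) := by
    filter_upwards [Ioo_mem_nhdsGT (zero_lt_one' ℝ)] with t ht
    have hconv := hr.2 hu hv (sub_nonneg.2 ht.2.le) ht.1.le (by ring)
    have hmem := hr.1 hu hv (sub_nonneg.2 ht.2.le) ht.1.le (by ring)
    have heq : (1 - t) • u + t • v = u + t • (v - u) := by module
    rw [heq] at hconv hmem
    have := hmin _ hmem
    rw [zero_add, zero_smul, add_zero, smul_eq_mul, inv_mul_eq_div, le_div_iff₀ ht.1]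
    simp only [smul_eq_mul] at hconv
    linarith
  simp only [zero_add, zero_smul, add_zero] at hev
  have := ge_of_tendsto hlim hev
  linarith

/-- The gradient inequality for convex functions. -/
theorem ConvexOn.add_inner_gradient_le {E : Type*} [NormedAddCommGroup E] [InnerProductSpace ℝ E]
    [CompleteSpace E] {C : Set E} {g : E → ℝ} {d u v : E} (hg : ConvexOn ℝ C g)
    (hu : u ∈ C) (hv : v ∈ C) (hd : HasGradientAt g d u) : g u + ⟪d, v - u⟫ ≤ g v := by
  have h := hg.le_add_fderiv_of_forall_le hu hv hd.hasFDerivAt.neg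
    (fun z _ => by simp)
  simp at h
  linarith

/-- The gradient inequality for concave functions. -/
theorem ConcaveOn.le_add_inner_gradient {E : Type*} [NormedAddCommGroup E] [InnerProductSpace ℝ E]
    [CompleteSpace E] {C : Set E} {g : E → ℝ} {d u v : E} (hg : ConcaveOn ℝ C g)
    (hu : u ∈ C) (hv : v ∈ C) (hd : HasGradientAt g d u) : g v ≤ g u + ⟪d, v - u⟫ := by
  have h := hg.neg.le_add_fderiv_of_forall_le hu hv hd.hasFDerivAt
    (fun z _ => by simp)
  simp at h
  linarith

/-- The three-point inequality for a Bregman proximal step. -/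
theorem ConvexOn.bregman_three_point {E : Type*} [NormedAddCommGroup E] [NormedSpace ℝ E]
    {C : Set E} {r φ : E → ℝ} {D : E → E → ℝ} {A : E → E →L[ℝ] ℝ} {s : E →L[ℝ] ℝ} {c : ℝ}
    {u v z : E} (hr : ConvexOn ℝ C r) (hu : u ∈ C) (hv : v ∈ C)
    (hφ : HasFDerivAt φ (A u) u) (hD : ∀ x y, D x y = φ x - φ y - A y (x - y))
    (hmin : ∀ x ∈ C, r u + s u + c * D u z ≤ r x + s x + c * D x z) :
    r u + s u + c * D u z + c * D v u ≤ r v + s v + c * D v z := by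
  have hder : HasFDerivAt (fun x => s x + c * (φ x - A z x)) (s + c • (A u - A z)) u :=
    s.hasFDerivAt.add ((hφ.sub (A z).hasFDerivAt).const_mul c)
  have h := hr.le_add_fderiv_of_forall_le hu hv hder fun x hx => by
    have := hmin x hx
    simp only [hD, map_sub] at this
    linarith
  simp only [hD, map_sub, add_apply, smul_apply, sub_apply, smul_eq_mul] at h ⊢
  linarith

theorem real_inner_le_young {E : Type*} [NormedAddCommGroup E] [InnerProductSpace ℝ E]
    (q u : E) {a : ℝ} (ha : 0 < a) :
    ⟪q, u⟫ ≤ 1 / (2 * a) * ‖q‖ ^ 2 + a * (1 / 2 * ‖u‖ ^ 2) := by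
  have h1 := real_inner_le_norm q u
  have h2 : 1 / (2 * a) * ‖q‖ ^ 2 + a * (1 / 2 * ‖u‖ ^ 2) - ‖q‖ * ‖u‖
      = 1 / (2 * a) * (‖q‖ - a * ‖u‖) ^ 2 := by field_simp; ring
  have h3 : 0 ≤ 1 / (2 * a) * (‖q‖ - a * ‖u‖) ^ 2 := by positivity
  linarith

theorem real_inner_add_le_young {E : Type*} [NormedAddCommGroup E] [InnerProductSpace ℝ E]
    (p q u : E) {a : ℝ} (ha : 0 < a) :
    ⟪p + q, u⟫ ≤ 1 / a * ‖p‖ ^ 2 + 1 / a * ‖q‖ ^ 2 + a * (1 / 2 * ‖u‖ ^ 2) := by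
  have h1 := real_inner_le_young (p + q) u ha
  have h2 : ‖p + q‖ ^ 2 ≤ 2 * (‖p‖ ^ 2 + ‖q‖ ^ 2) := by
    have := parallelogram_law_with_norm ℝ p q
    nlinarith [sq_nonneg ‖p - q‖]
  have h3 : 1 / (2 * a) * ‖p + q‖ ^ 2 ≤ 1 / (2 * a) * (2 * (‖p‖ ^ 2 + ‖q‖ ^ 2)) := by gcongr
  have h4 : 1 / (2 * a) * (2 * (‖p‖ ^ 2 + ‖q‖ ^ 2)) = 1 / a * ‖p‖ ^ 2 + 1 / a * ‖q‖ ^ 2 := by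
    field_simp
  linarith

/-- Weighted telescoping of a primal-dual descent inequality with extrapolation. -/
theorem sum_mul_le_of_telescoping {t τ σ η a b c g : ℕ → ℝ} {K : ℕ}
    (ht : ∀ k, 0 < t k) (htτ : ∀ k, t (k + 1) / τ (k + 1) ≤ t k / τ k)
    (htσ : ∀ k, t (k + 1) / σ (k + 1) ≤ t k / σ k)
    (htη : ∀ k, t k / t (k + 1) = η (k + 1))
    (ha : ∀ k, 0 ≤ a k) (hb : ∀ k, 0 ≤ b k) (hc : c 0 = 0)
    (hstep : ∀ k < K, g k ≤ 1 / τ k * (a k - a (k + 1)) + 1 / σ k * (b k - b (k + 1))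
      + c (k + 1) - η k * c k) :
    ∑ k ∈ Finset.range K, t k * g k + t K / τ K * a K + t K / σ K * b K
      ≤ t 0 / τ 0 * a 0 + t 0 / σ 0 * b 0 + t K * η K * c K := by
  induction K with
  | zero => simp [hc]
  | succ K ih =>
    have h1 := ih fun k hk => hstep k (by omega)
    have h2 := mul_le_mul_of_nonneg_left (hstep K (by omega)) (ht K).le
    have h3 := mul_le_mul_of_nonneg_right (htτ K) (ha (K + 1))
    have h4 := mul_le_mul_of_nonneg_right (htσ K) (hb (K + 1))
    have h5 : t (K + 1) * η (K + 1) = t K := by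
      rw [← htη K]; field_simp [(ht (K + 1)).ne']
    rw [Finset.sum_range_succ, h5]
    simp only [div_eq_mul_inv] at *
    linarith

theorem sum_range_one_div_add_one_sq_le (K : ℕ) :
    ∑ k ∈ Finset.range K, 1 / ((k : ℝ) + 1) ^ 2 ≤ Real.pi ^ 2 / 6 := by
  have h := sum_le_hasSum (Finset.range (K + 1)) (fun i _ => by positivity) hasSum_zeta_two
  rw [Finset.sum_range_succ'] at h
  simpa using h

theorem stmt_11
    {X : Type*} [NormedAddCommGroup X] [InnerProductSpace ℝ X] [FiniteDimensional ℝ X]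
    {Y : Type*} [NormedAddCommGroup Y] [InnerProductSpace ℝ Y] [FiniteDimensional ℝ Y]
    {T : Type*} [NormedAddCommGroup T] [InnerProductSpace ℝ T] [FiniteDimensional ℝ T]
    (domf : Set X) (domh : Set Y) (Θset : Set T)
    (hdomf_ne : domf.Nonempty) (hdomh_ne : domh.Nonempty)
    (hdomf_conv : Convex ℝ domf) (hdomh_conv : Convex ℝ domh)
    (hΘ_conv : Convex ℝ Θset) (hΘ_ne : Θset.Nonempty)
    (B : ℝ) (hB : 0 < B) (ε : ℝ) (hε : 0 < ε) (ℓstar : ℝ)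
    (f : X → ℝ) (h : Y → ℝ)
    (hfconv : ConvexOn ℝ domf f) (hhconv : ConvexOn ℝ domh h)
    (hflsc : LowerSemicontinuousOn f domf) (hhlsc : LowerSemicontinuousOn h domh)
    (g1 : X → T → ℝ) (g2 : X → Y → ℝ) (ℓf : T → ℝ)
    (g1x : X → T → X) (g1θ : X → T → T)
    (g2x : X → Y → X) (g2y : X → Y → Y) (gℓ : T → T)
    (L1xx L1xθ L2xx L2xy L2yx L2yy L1θx L1θθ Lℓθ Lℓw : ℝ)
    (hL1xx : 0 ≤ L1xx) (hL1xθ : 0 ≤ L1xθ) (hL2xx : 0 ≤ L2xx) (hL2xy : 0 ≤ L2xy)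
    (hL2yx : 0 ≤ L2yx) (hL2yy : 0 ≤ L2yy) (hL1θx : 0 ≤ L1θx) (hL1θθ : 0 ≤ L1θθ)
    (hLℓθ : 0 ≤ Lℓθ) (hLℓw : 0 ≤ Lℓw)
    (hg1convx : ∀ θ ∈ Θset, ConvexOn ℝ domf (fun x => g1 x θ))
    (hg2convx : ∀ y ∈ domh, ConvexOn ℝ domf (fun x => g2 x y))
    (hg1x : ∀ x ∈ domf, ∀ θ ∈ Θset, HasGradientAt (fun x' => g1 x' θ) (g1x x θ) x)
    (hg1θ : ∀ x ∈ domf, ∀ θ ∈ Θset, HasGradientAt (fun θ' => g1 x θ') (g1θ x θ) θ)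
    (hg2x : ∀ x ∈ domf, ∀ y ∈ domh, HasGradientAt (fun x' => g2 x' y) (g2x x y) x)
    (hg2y : ∀ x ∈ domf, ∀ y ∈ domh, HasGradientAt (fun y' => g2 x y') (g2y x y) y)
    (hgℓ : ∀ θ ∈ Θset, HasGradientAt ℓf (gℓ θ) θ)
    (hLip1x : ∀ x ∈ domf, ∀ x' ∈ domf, ∀ θ ∈ Θset, ∀ θ' ∈ Θset,
      ‖g1x x θ - g1x x' θ'‖ ≤ L1xx * ‖x - x'‖ + L1xθ * ‖θ - θ'‖)
    (hLip2x : ∀ x ∈ domf, ∀ x' ∈ domf, ∀ y ∈ domh, ∀ y' ∈ domh,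
      ‖g2x x y - g2x x' y'‖ ≤ L2xx * ‖x - x'‖ + L2xy * ‖y - y'‖)
    (hLip2y : ∀ x ∈ domf, ∀ x' ∈ domf, ∀ y ∈ domh, ∀ y' ∈ domh,
      ‖g2y x y - g2y x' y'‖ ≤ L2yx * ‖x - x'‖ + L2yy * ‖y - y'‖)
    (hLip1θ : ∀ x ∈ domf, ∀ x' ∈ domf, ∀ θ ∈ Θset, ∀ θ' ∈ Θset,
      ‖g1θ x θ - g1θ x' θ'‖ ≤ L1θx * ‖x - x'‖ + L1θθ * ‖θ - θ'‖)
    (hLipℓ : ∀ θ ∈ Θset, ∀ θ' ∈ Θset, ∀ w ∈ Set.Icc (0 : ℝ) B, ∀ w' ∈ Set.Icc (0 : ℝ) B,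
      ‖w' • gℓ θ' - w • gℓ θ‖ ≤ Lℓθ * ‖θ - θ'‖ + Lℓw * |w - w'|)
    (hg1conc : ∀ x ∈ domf, ConcaveOn ℝ Θset (fun θ => g1 x θ))
    (hg2conc : ∀ x ∈ domf, ConcaveOn ℝ domh (fun y => g2 x y))
    (hℓconv : ConvexOn ℝ Θset ℓf)
    (φX : X → ℝ) (gφX : X → X) (UX : Set X) (hUXopen : IsOpen UX) (hUXf : domf ⊆ UX)
    (hφX : ∀ x ∈ UX, HasGradientAt φX (gφX x) x)
    (DX : X → X → ℝ)
    (hDXdef : ∀ x x', DX x x' = φX x - φX x' - ⟪gφX x', x - x'⟫)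
    (hDXlb : ∀ x, ∀ x' ∈ domf, 1 / 2 * ‖x - x'‖ ^ 2 ≤ DX x x')
    (φY : Y → ℝ) (gφY : Y → Y) (UY : Set Y) (hUYopen : IsOpen UY) (hUYh : domh ⊆ UY)
    (hφY : ∀ y ∈ UY, HasGradientAt φY (gφY y) y)
    (DY : Y → Y → ℝ)
    (hDYdef : ∀ y y', DY y y' = φY y - φY y' - ⟪gφY y', y - y'⟫)
    (hDYlb : ∀ y, ∀ y' ∈ domh, 1 / 2 * ‖y - y'‖ ^ 2 ≤ DY y y')
    (φT : T → ℝ) (gφT : T → T) (UT : Set T) (hUTopen : IsOpen UT) (hUTθ : Θset ⊆ UT)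
    (hφT : ∀ θ ∈ UT, HasGradientAt φT (gφT θ) θ)
    (DΘ : T → T → ℝ)
    (hDΘdef : ∀ θ θ', DΘ θ θ' = φT θ - φT θ' - ⟪gφT θ', θ - θ'⟫)
    (hDΘlb : ∀ θ, ∀ θ' ∈ Θset, 1 / 2 * ‖θ - θ'‖ ^ 2 ≤ DΘ θ θ')
    (φW : ℝ → ℝ) (dφW : ℝ → ℝ) (UW : Set ℝ) (hUWopen : IsOpen UW) (hUWw : Set.Icc (0 : ℝ) B ⊆ UW)
    (hφW : ∀ w ∈ UW, HasDerivAt φW (dφW w) w)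
    (DW : ℝ → ℝ → ℝ)
    (hDWdef : ∀ w w', DW w w' = φW w - φW w' - dφW w' * (w - w'))
    (hDWlb : ∀ w : ℝ, ∀ w' ∈ Set.Icc (0 : ℝ) B, 1 / 2 * |w - w'| ^ 2 ≤ DW w w')
    (τs σs ηs αs βs : ℕ → ℝ)
    (hτs : ∀ k, 0 < τs k) (hσs : ∀ k, 0 < σs k) (hηs : ∀ k, 0 ≤ ηs k)
    (hαs : ∀ k, 0 < αs k) (hβs : ∀ k, 0 < βs k)
    (xx : ℕ → X) (ww : ℕ → ℝ) (yy : ℕ → Y) (θθ : ℕ → T) (ℓk : ℕ → ℝ)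
    (hxx : ∀ k, xx k ∈ domf) (hww : ∀ k, ww k ∈ Set.Icc (0 : ℝ) B)
    (hyy : ∀ k, yy k ∈ domh) (hθθ : ∀ k, θθ k ∈ Θset)
    (hyupd : ∀ k : ℕ, ∀ y' ∈ domh,
      h (yy (k + 1))
        - ⟪(1 + ηs k) • g2y (xx k) (yy k) - ηs k • g2y (xx (k - 1)) (yy (k - 1)), yy (k + 1)⟫
        + 1 / σs k * DY (yy (k + 1)) (yy k)
      ≤ h y'
        - ⟪(1 + ηs k) • g2y (xx k) (yy k) - ηs k • g2y (xx (k - 1)) (yy (k - 1)), y'⟫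
        + 1 / σs k * DY y' (yy k))
    (hθupd : ∀ k : ℕ, ∀ θ' ∈ Θset,
      -⟪(1 + ηs k) • (g1θ (xx k) (θθ k) - ww k • gℓ (θθ k))
          - ηs k • (g1θ (xx (k - 1)) (θθ (k - 1)) - ww (k - 1) • gℓ (θθ (k - 1))), θθ (k + 1)⟫
        + 1 / σs k * DΘ (θθ (k + 1)) (θθ k)
      ≤ -⟪(1 + ηs k) • (g1θ (xx k) (θθ k) - ww k • gℓ (θθ k))
          - ηs k • (g1θ (xx (k - 1)) (θθ (k - 1)) - ww (k - 1) • gℓ (θθ (k - 1))), θ'⟫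
        + 1 / σs k * DΘ θ' (θθ k))
    (hxupd : ∀ k : ℕ, ∀ x' ∈ domf,
      f (xx (k + 1)) + ⟪g1x (xx k) (θθ (k + 1)) + g2x (xx k) (yy (k + 1)), xx (k + 1)⟫
        + 1 / τs k * DX (xx (k + 1)) (xx k)
      ≤ f x' + ⟪g1x (xx k) (θθ (k + 1)) + g2x (xx k) (yy (k + 1)), x'⟫
        + 1 / τs k * DX x' (xx k))
    (hwupd : ∀ k : ℕ, ∀ w' ∈ Set.Icc (0 : ℝ) B,
      -((ℓf (θθ (k + 1)) - ℓk (k + 1) - ε) * ww (k + 1)) + 1 / τs k * DW (ww (k + 1)) (ww k)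
      ≤ -((ℓf (θθ (k + 1)) - ℓk (k + 1) - ε) * w') + 1 / τs k * DW w' (ww k))
    (ts : ℕ → ℝ) (htpos : ∀ k, 0 < ts k) (ht0 : ts 0 = 1)
    (htτ : ∀ k : ℕ, ts (k + 1) / τs (k + 1) ≤ ts k / τs k)
    (htσ : ∀ k : ℕ, ts (k + 1) / σs (k + 1) ≤ ts k / σs k)
    (htη : ∀ k : ℕ, ts k / ts (k + 1) = ηs (k + 1))
    (hts1 : ∀ k : ℕ, ts k ≤ 1)
    (Rx Rw Ry Rθ : ℝ)
    (hRx : ∀ x ∈ domf, ∀ x' ∈ domf, DX x x' ≤ Rx)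
    (hRw : ∀ w ∈ Set.Icc (0 : ℝ) B, ∀ w' ∈ Set.Icc (0 : ℝ) B, DW w w' ≤ Rw)
    (hRy : ∀ y ∈ domh, ∀ y' ∈ domh, DY y y' ≤ Ry)
    (hRθ : ∀ θ ∈ Θset, ∀ θ' ∈ Θset, DΘ θ θ' ≤ Rθ)
    (c₀ c₁ : ℝ) (hc₀ : 0 < c₀) (hc₁ : 0 < c₁)
    (hBc : B ≤ c₀ / ε)
    (hℓrate : ∀ k : ℕ, |ℓk (k + 1) - ℓstar| ≤ c₁ / ((k : ℝ) + 1) ^ 2)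
    (xstar : X) (wstar : ℝ) (ystar : Y) (θsp : T)
    (hxstar : xstar ∈ domf) (hwstar : wstar ∈ Set.Icc (0 : ℝ) B)
    (hystar : ystar ∈ domh) (hθsp : θsp ∈ Θset)
    (hwstar1 : wstar + 1 ∈ Set.Icc (0 : ℝ) B)
    (hsaddle : ∀ x ∈ domf, ∀ w ∈ Set.Icc (0 : ℝ) B, ∀ y ∈ domh, ∀ θ ∈ Θset,
      (f xstar + g1 xstar θ + g2 xstar y - wstar * (ℓf θ - ℓstar - ε) - h y)
        ≤ (f xstar + g1 xstar θsp + g2 xstar ystar - wstar * (ℓf θsp - ℓstar - ε) - h ystar)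
      ∧ (f xstar + g1 xstar θsp + g2 xstar ystar - wstar * (ℓf θsp - ℓstar - ε) - h ystar)
        ≤ (f x + g1 x θsp + g2 x ystar - w * (ℓf θsp - ℓstar - ε) - h ystar))
    :
    ∀ K : ℕ, 1 ≤ K →
    (∀ k < K,
      (g1 (xx (k + 1)) (θθ (k + 1)) - g1 (xx k) (θθ (k + 1))
          - ⟪g1x (xx k) (θθ (k + 1)), xx (k + 1) - xx k⟫)
        + (g2 (xx (k + 1)) (yy (k + 1)) - g2 (xx k) (yy (k + 1))
            - ⟪g2x (xx k) (yy (k + 1)), xx (k + 1) - xx k⟫)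
        + 1 / (2 * αs (k + 1)) * ‖g2y (xx (k + 1)) (yy (k + 1)) - g2y (xx k) (yy (k + 1))‖ ^ 2
        + 1 / βs (k + 1) * ‖g2y (xx k) (yy (k + 1)) - g2y (xx k) (yy k)‖ ^ 2
        + 1 / αs (k + 1) * ‖g1θ (xx (k + 1)) (θθ (k + 1)) - g1θ (xx k) (θθ (k + 1))‖ ^ 2
        + 1 / αs (k + 1) * ‖g1θ (xx k) (θθ (k + 1)) - g1θ (xx k) (θθ k)‖ ^ 2
        + 1 / βs (k + 1) * ‖(ww k - ww (k + 1)) • gℓ (θθ (k + 1))‖ ^ 2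
        + 1 / βs (k + 1) * ‖ww k • (gℓ (θθ k) - gℓ (θθ (k + 1)))‖ ^ 2
        - (1 / σs k - ηs k * (αs k + βs k)) * (DY (yy (k + 1)) (yy k) + DΘ (θθ (k + 1)) (θθ k))
        - 1 / τs k * (DX (xx (k + 1)) (xx k) + DW (ww (k + 1)) (ww k)) ≤ 0) →
    1 / σs K ≥ ηs K * (αs K + βs K) →
    ∀ TK : ℝ, TK = ∑ k ∈ Finset.range K, ts k →
    ∀ xb : X, xb = TK⁻¹ • ∑ k ∈ Finset.range K, ts k • xx (k + 1) →
    ∀ wb : ℝ, wb = TK⁻¹ * ∑ k ∈ Finset.range K, ts k * ww (k + 1) →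
    ∀ yb : Y, yb = TK⁻¹ • ∑ k ∈ Finset.range K, ts k • yy (k + 1) →
    ∀ θb : T, θb = TK⁻¹ • ∑ k ∈ Finset.range K, ts k • θθ (k + 1) →
    (ℓf θb - ℓstar
      ≤ 1 / TK * (Rx / τs 0 + Rw / τs 0 + Ry / σs 0 + Rθ / σs 0)
        + c₀ * c₁ * Real.pi ^ 2 / (3 * TK * ε) + ε)
    ∧ (ε = 1 / Real.sqrt (K : ℝ) →
        1 / TK * (Rx / τs 0 + Rw / τs 0 + Ry / σs 0 + Rθ / σs 0)
          + c₀ * c₁ * Real.pi ^ 2 / (3 * TK * ε) + ε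
        = 1 / TK * (Rx / τs 0 + Rw / τs 0 + Ry / σs 0 + Rθ / σs 0)
          + c₀ * c₁ * Real.pi ^ 2 * Real.sqrt (K : ℝ) / (3 * TK)
          + 1 / Real.sqrt (K : ℝ)) := by
  intro K hK hcond hσK TK hTK xb hxb wb hwb yb hyb θb hθb
  have hTpos : 0 < TK := by
    rw [hTK]
    exact Finset.sum_pos (fun k _ => htpos k) (Finset.nonempty_range_iff.2 (by omega))
  refine ⟨?_, fun hεK => ?_⟩
  swap
  · have hKs : 0 < Real.sqrt (K : ℝ) := Real.sqrt_pos.2 (by exact_mod_cast hK)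
    rw [hεK]
    field_simp
  have hDX0 : ∀ x, ∀ x' ∈ domf, 0 ≤ DX x x' := fun x x' hx' =>
    le_trans (by positivity) (hDXlb x x' hx')
  have hDY0 : ∀ x, ∀ x' ∈ domh, 0 ≤ DY x x' := fun x x' hx' =>
    le_trans (by positivity) (hDYlb x x' hx')
  have hDΘ0 : ∀ x, ∀ x' ∈ Θset, 0 ≤ DΘ x x' := fun x x' hx' =>
    le_trans (by positivity) (hDΘlb x x' hx')
  have hDW0 : ∀ x, ∀ x' ∈ Set.Icc (0 : ℝ) B, 0 ≤ DW x x' := fun x x' hx' =>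
    le_trans (by positivity) (hDWlb x x' hx')
  set w : ℝ := wstar + 1 with hw
  -- Dual extrapolation errors and the Young-type bound they admit.
  set Fy : ℕ → Y := fun k => g2y (xx k) (yy k) with hFy
  set Fθ : ℕ → T := fun k => g1θ (xx k) (θθ k) - ww k • gℓ (θθ k) with hFθ
  set E : ℕ → ℝ := fun k =>
    1 / (2 * αs k) * ‖g2y (xx k) (yy k) - g2y (xx (k - 1)) (yy k)‖ ^ 2
      + 1 / βs k * ‖g2y (xx (k - 1)) (yy k) - g2y (xx (k - 1)) (yy (k - 1))‖ ^ 2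
      + 1 / αs k * ‖g1θ (xx k) (θθ k) - g1θ (xx (k - 1)) (θθ k)‖ ^ 2
      + 1 / αs k * ‖g1θ (xx (k - 1)) (θθ k) - g1θ (xx (k - 1)) (θθ (k - 1))‖ ^ 2
      + 1 / βs k * ‖(ww (k - 1) - ww k) • gℓ (θθ k)‖ ^ 2
      + 1 / βs k * ‖ww (k - 1) • (gℓ (θθ (k - 1)) - gℓ (θθ k))‖ ^ 2 with hE
  have hcross : ∀ k y θ, ⟪Fy k - Fy (k - 1), y - yy k⟫ + ⟪Fθ k - Fθ (k - 1), θ - θθ k⟫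
      ≤ E k + (αs k + βs k) * (DY y (yy k) + DΘ θ (θθ k)) := by
    intro k y θ
    have e1 : Fy k - Fy (k - 1) = (g2y (xx k) (yy k) - g2y (xx (k - 1)) (yy k))
        + (g2y (xx (k - 1)) (yy k) - g2y (xx (k - 1)) (yy (k - 1))) := by
      simp only [hFy]; abel
    have e2 : Fθ k - Fθ (k - 1) = ((g1θ (xx k) (θθ k) - g1θ (xx (k - 1)) (θθ k))
        + (g1θ (xx (k - 1)) (θθ k) - g1θ (xx (k - 1)) (θθ (k - 1))))
        + ((ww (k - 1) - ww k) • gℓ (θθ k)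
          + ww (k - 1) • (gℓ (θθ (k - 1)) - gℓ (θθ k))) := by
      simp only [hFθ]; module
    rw [e1, e2, inner_add_left, inner_add_left (_ + _)]
    have y1 := real_inner_le_young (g2y (xx k) (yy k) - g2y (xx (k - 1)) (yy k)) (y - yy k) (hαs k)
    have y2 := real_inner_le_young
      (g2y (xx (k - 1)) (yy k) - g2y (xx (k - 1)) (yy (k - 1))) (y - yy k) (hβs k)
    have y3 := real_inner_add_le_young (g1θ (xx k) (θθ k) - g1θ (xx (k - 1)) (θθ k))
      (g1θ (xx (k - 1)) (θθ k) - g1θ (xx (k - 1)) (θθ (k - 1))) (θ - θθ k) (hαs k)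
    have y4 := real_inner_add_le_young ((ww (k - 1) - ww k) • gℓ (θθ k))
      (ww (k - 1) • (gℓ (θθ (k - 1)) - gℓ (θθ k))) (θ - θθ k) (hβs k)
    have hab : 0 ≤ αs k + βs k := (add_pos (hαs k) (hβs k)).le
    have d1 := mul_le_mul_of_nonneg_left (hDYlb y _ (hyy k)) hab
    have d2 := mul_le_mul_of_nonneg_left (hDΘlb θ _ (hθθ k)) hab
    have b1 : 1 / (2 * βs k) * ‖g2y (xx (k - 1)) (yy k) - g2y (xx (k - 1)) (yy (k - 1))‖ ^ 2
        ≤ 1 / βs k * ‖g2y (xx (k - 1)) (yy k) - g2y (xx (k - 1)) (yy (k - 1))‖ ^ 2 := by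
      have := hβs k
      gcongr
      linarith
    simp only [hE]
    linarith
  -- The one-step inequality at the comparison point.
  have hstep : ∀ k < K, ℓf (θθ (k + 1)) - ℓstar - ε - (w - ww (k + 1)) * (ℓk (k + 1) - ℓstar)
      ≤ 1 / τs k * ((DX xstar (xx k) + DW w (ww k))
          - (DX xstar (xx (k + 1)) + DW w (ww (k + 1))))
        + 1 / σs k * ((DY ystar (yy k) + DΘ θsp (θθ k))
          - (DY ystar (yy (k + 1)) + DΘ θsp (θθ (k + 1))))
        + (⟪Fy (k + 1) - Fy (k + 1 - 1), ystar - yy (k + 1)⟫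
            + ⟪Fθ (k + 1) - Fθ (k + 1 - 1), θsp - θθ (k + 1)⟫ - E (k + 1))
        - ηs k * (⟪Fy k - Fy (k - 1), ystar - yy k⟫
            + ⟪Fθ k - Fθ (k - 1), θsp - θθ k⟫ - E k) := by
    intro k hk
    have px := hfconv.bregman_three_point (c := 1 / τs k) (z := xx k) (s := innerSL ℝ
        (g1x (xx k) (θθ (k + 1)) + g2x (xx k) (yy (k + 1)))) (A := fun x => innerSL ℝ (gφX x))
      (hxx (k + 1)) hxstar
      (hφX _ (hUXf (hxx (k + 1)))).hasFDerivAt (fun x y => by simpa using hDXdef x y)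
      (hxupd k)
    have py := hhconv.bregman_three_point (c := 1 / σs k) (z := yy k)
      (s := innerSL ℝ (-((1 + ηs k) • g2y (xx k) (yy k)
        - ηs k • g2y (xx (k - 1)) (yy (k - 1))))) (A := fun x => innerSL ℝ (gφY x))
      (hyy (k + 1)) hystar
      (hφY _ (hUYh (hyy (k + 1)))).hasFDerivAt (fun x y => by simpa using hDYdef x y)
      (fun x hx => by
        have := hyupd k x hx
        simp only [innerSL_apply_apply, inner_neg_left]
        linarith)
    have pθ := (convexOn_const (0 : ℝ) hΘ_conv).bregman_three_point
      (c := 1 / σs k) (z := θθ k)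
      (s := innerSL ℝ (-((1 + ηs k) • (g1θ (xx k) (θθ k) - ww k • gℓ (θθ k))
          - ηs k • (g1θ (xx (k - 1)) (θθ (k - 1)) - ww (k - 1) • gℓ (θθ (k - 1))))))
      (A := fun x => innerSL ℝ (gφT x)) (hθθ (k + 1)) hθsp
      (hφT _ (hUTθ (hθθ (k + 1)))).hasFDerivAt (fun x y => by simpa using hDΘdef x y)
      (fun x hx => by
        have := hθupd k x hx
        simp only [innerSL_apply_apply, inner_neg_left]
        linarith)
    have pw := (convexOn_const (0 : ℝ) (convex_Icc (0 : ℝ) B)).bregman_three_point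
      (c := 1 / τs k) (z := ww k) (D := DW)
      (s := ContinuousLinearMap.toSpanSingleton ℝ (-(ℓf (θθ (k + 1)) - ℓk (k + 1) - ε)))
      (A := fun x => ContinuousLinearMap.toSpanSingleton ℝ (dφW x)) (hww (k + 1)) hwstar1
      (hφW _ (hUWw (hww (k + 1)))).hasFDerivAt
      (fun x y => by
        rw [hDWdef, ContinuousLinearMap.toSpanSingleton_apply, smul_eq_mul]; ring)
      (fun x hx => by
        have := hwupd k x hx
        simp only [ContinuousLinearMap.toSpanSingleton_apply, smul_eq_mul]
        linarith)
    simp only [innerSL_apply_apply, ContinuousLinearMap.toSpanSingleton_apply, smul_eq_mul]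
      at px py pθ pw
    have s1 := (hsaddle xstar hxstar wstar hwstar (yy (k + 1)) (hyy _) (θθ (k + 1)) (hθθ _)).1
    have s2 := (hsaddle (xx (k + 1)) (hxx _) (ww (k + 1)) (hww _) ystar hystar θsp hθsp).2
    have c1 := (hg1convx _ (hθθ (k + 1))).add_inner_gradient_le (hxx k) hxstar
      (hg1x _ (hxx k) _ (hθθ (k + 1)))
    have c2 := (hg2convx _ (hyy (k + 1))).add_inner_gradient_le (hxx k) hxstar
      (hg2x _ (hxx k) _ (hyy (k + 1)))
    have c3 := (hg1conc _ (hxx (k + 1))).le_add_inner_gradient (hθθ (k + 1)) hθsp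
      (hg1θ _ (hxx (k + 1)) _ (hθθ (k + 1)))
    have c4 := (hg2conc _ (hxx (k + 1))).le_add_inner_gradient (hyy (k + 1)) hystar
      (hg2y _ (hxx (k + 1)) _ (hyy (k + 1)))
    have c5 := mul_le_mul_of_nonneg_left
      (hℓconv.add_inner_gradient_le (hθθ (k + 1)) hθsp (hgℓ _ (hθθ (k + 1)))) (hww (k + 1)).1
    have c6 := mul_le_mul_of_nonneg_left (hcross k (yy (k + 1)) (θθ (k + 1))) (hηs k)
    have c7 := hcond k hk
    simp only [hE, Nat.add_sub_cancel, hFy, hFθ, inner_sub_left, inner_sub_right, inner_add_left,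
      inner_neg_left, real_inner_smul_left, hw] at px py pθ pw c1 c2 c3 c4 c5 c6 c7 ⊢
    linarith
  have hsum := sum_mul_le_of_telescoping
    (c := fun k => ⟪Fy k - Fy (k - 1), ystar - yy k⟫ + ⟪Fθ k - Fθ (k - 1), θsp - θθ k⟫ - E k)
    (b := fun k => DY ystar (yy k) + DΘ θsp (θθ k))
    (a := fun k => DX xstar (xx k) + DW w (ww k)) htpos htτ htσ htη
    (fun k => add_nonneg (hDX0 _ _ (hxx k)) (hDW0 _ _ (hww k)))
    (fun k => add_nonneg (hDY0 _ _ (hyy k)) (hDΘ0 _ _ (hθθ k))) (by simp [hE]) hstep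
  have hgap : ∑ k ∈ Finset.range K, ts k *
      (ℓf (θθ (k + 1)) - ℓstar - ε - (w - ww (k + 1)) * (ℓk (k + 1) - ℓstar))
      ≤ Rx / τs 0 + Rw / τs 0 + Ry / σs 0 + Rθ / σs 0 := by
    have r1 := div_le_div_of_nonneg_right (hRx _ hxstar _ (hxx 0)) (hτs 0).le
    have r2 := div_le_div_of_nonneg_right (hRw _ hwstar1 _ (hww 0)) (hτs 0).le
    have r3 := div_le_div_of_nonneg_right (hRy _ hystar _ (hyy 0)) (hσs 0).le
    have r4 := div_le_div_of_nonneg_right (hRθ _ hθsp _ (hθθ 0)) (hσs 0).le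
    have b0 : 0 ≤ DY ystar (yy K) + DΘ θsp (θθ K) :=
      add_nonneg (hDY0 _ _ (hyy K)) (hDΘ0 _ _ (hθθ K))
    have a0 : 0 ≤ ts K / τs K * (DX xstar (xx K) + DW w (ww K)) :=
      mul_nonneg (div_nonneg (htpos K).le (hτs K).le)
        (add_nonneg (hDX0 _ _ (hxx K)) (hDW0 _ _ (hww K)))
    have q1 := mul_le_mul_of_nonneg_left (hcross K ystar θsp)
      (mul_nonneg (htpos K).le (hηs K))
    have q2 := mul_le_mul_of_nonneg_left (mul_le_mul_of_nonneg_right hσK b0) (htpos K).le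
    simp only [ht0, div_eq_mul_inv] at hsum r1 r2 r3 r4 a0 q1 q2 ⊢
    linarith
  have herr : ∑ k ∈ Finset.range K, ts k * ((w - ww (k + 1)) * (ℓk (k + 1) - ℓstar))
      ≤ c₀ * c₁ * Real.pi ^ 2 / (3 * ε) := by
    have hterm : ∀ k ∈ Finset.range K, ts k * ((w - ww (k + 1)) * (ℓk (k + 1) - ℓstar))
        ≤ c₀ / ε * c₁ * (1 / ((k : ℝ) + 1) ^ 2) := by
      intro k _
      have h1 : |w - ww (k + 1)| ≤ c₀ / ε :=
        (abs_sub_le_of_le_of_le hwstar1.1 hwstar1.2 (hww _).1 (hww _).2).trans (by linarith)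
      calc ts k * ((w - ww (k + 1)) * (ℓk (k + 1) - ℓstar))
          ≤ ts k * |(w - ww (k + 1)) * (ℓk (k + 1) - ℓstar)| :=
            mul_le_mul_of_nonneg_left (le_abs_self _) (htpos k).le
        _ ≤ 1 * (|w - ww (k + 1)| * |ℓk (k + 1) - ℓstar|) := by
            rw [abs_mul]
            exact mul_le_mul_of_nonneg_right (hts1 k) (by positivity)
        _ ≤ 1 * (c₀ / ε * (c₁ / ((k : ℝ) + 1) ^ 2)) := by
            have := hℓrate k
            gcongr
        _ = c₀ / ε * c₁ * (1 / ((k : ℝ) + 1) ^ 2) := by ring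
    refine (Finset.sum_le_sum hterm).trans ?_
    rw [← Finset.mul_sum]
    have hp : 0 ≤ c₀ / ε * c₁ := by positivity
    refine (mul_le_mul_of_nonneg_left (sum_range_one_div_add_one_sq_le K) hp).trans ?_
    have h6 : c₀ * c₁ * Real.pi ^ 2 / (3 * ε) = 2 * (c₀ / ε * c₁ * (Real.pi ^ 2 / 6)) := by
      field_simp
      norm_num
    have : 0 ≤ c₀ / ε * c₁ * (Real.pi ^ 2 / 6) := by positivity
    linarith
  have hjensen : ℓf θb ≤ TK⁻¹ * ∑ k ∈ Finset.range K, ts k * ℓf (θθ (k + 1)) := by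
    have hθb' : θb = ∑ k ∈ Finset.range K, (TK⁻¹ * ts k) • θθ (k + 1) := by
      simp only [hθb, Finset.smul_sum, smul_smul]
    rw [hθb', Finset.mul_sum]
    refine (hℓconv.map_sum_le (fun k _ => mul_nonneg (inv_nonneg.2 hTpos.le) (htpos k).le)
      ?_ (fun k _ => hθθ (k + 1))).trans_eq ?_
    · rw [← Finset.mul_sum, ← hTK, inv_mul_cancel₀ hTpos.ne']
    · simp only [smul_eq_mul, mul_assoc]
  have hsplit : ∑ k ∈ Finset.range K, ts k *
      (ℓf (θθ (k + 1)) - ℓstar - ε - (w - ww (k + 1)) * (ℓk (k + 1) - ℓstar))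
      = ∑ k ∈ Finset.range K, ts k * ℓf (θθ (k + 1)) - TK * (ℓstar + ε)
        - ∑ k ∈ Finset.range K, ts k * ((w - ww (k + 1)) * (ℓk (k + 1) - ℓstar)) := by
    rw [hTK, Finset.sum_mul, ← Finset.sum_sub_distrib, ← Finset.sum_sub_distrib]
    exact Finset.sum_congr rfl fun k _ => by ring
  have htotal : ∑ k ∈ Finset.range K, ts k * ℓf (θθ (k + 1))
      ≤ (Rx / τs 0 + Rw / τs 0 + Ry / σs 0 + Rθ / σs 0)
        + c₀ * c₁ * Real.pi ^ 2 / (3 * ε) + TK * (ℓstar + ε) := by linarith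
  have hfin := hjensen.trans (mul_le_mul_of_nonneg_left htotal (inv_nonneg.2 hTpos.le))
  have hcalc : TK⁻¹ * ((Rx / τs 0 + Rw / τs 0 + Ry / σs 0 + Rθ / σs 0)
        + c₀ * c₁ * Real.pi ^ 2 / (3 * ε) + TK * (ℓstar + ε))
      = 1 / TK * (Rx / τs 0 + Rw / τs 0 + Ry / σs 0 + Rθ / σs 0)
        + c₀ * c₁ * Real.pi ^ 2 / (3 * TK * ε) + ε + ℓstar := by
    generalize Rx / τs 0 + Rw / τs 0 + Ry / σs 0 + Rθ / σs 0 = R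
    field_simp
    ring
  linarith
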